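/- arXiv:2401.11018 — 4 statements merged into one kernel-verified Lean document; each statement's English description precedes it below -/
import Mathlib

section
/- Fix positive integers R, K, E, M, N, b with b ≤ N, a target client index k_u ∈ Fin M, and a target element x of a finite set D with |D| = N. Consider the probability distribution on sampling histories given by the product over rounds r ∈ Fin R of independent uniform samples: in each round r, a tuple of K client indices drawn i.i.d. uniformly from Fin M, and, independently, a tuple of E mini-batches drawn i.i.d. uniformly from the family of b-element subsets of D (the mini-batches of the target client in that round). Then the probability that there exists a round r such that k_u appears among the K client indices drawn in round r and x belongs to at least one of the E mini-batches drawn in round r is at most R·K·E·b/(M·N). -/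
open MeasureTheory
open scoped ENNReal

/-- Among the functions `ι → X`, the proportion of those whose value at `i` satisfies `p` is the
proportion of elements of `X` satisfying `p`. -/
lemma Nat.card_subtype_eval_mul {ι X : Type*} [Finite ι] [Finite X] (i : ι) (p : X → Prop) :
    Nat.card {f : ι → X // p (f i)} * Nat.card X = Nat.card {y // p y} * Nat.card (ι → X) := by
  classical
  have e₁ : {f : ι → X // p (f i)} ≃ {y // p y} × ({j // j ≠ i} → X) :=
    ((Equiv.funSplitAt i X).subtypeEquiv (q := fun y ↦ p y.1) fun _ ↦ Iff.rfl).trans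
      Equiv.prodSubtypeFstEquivSubtypeProd
  rw [Nat.card_congr e₁, Nat.card_congr (Equiv.funSplitAt i X), Nat.card_prod, Nat.card_prod]
  ring

/-- Double counting of pairs of an element and a `b`-element subset, for a fixed element. -/
lemma Finset.card_mem_powersetCard_mul_card {α : Type*} [DecidableEq α] {D : Finset α} {x : α}
    (hx : x ∈ D) {b : ℕ} (hb : 0 < b) :
    Nat.card {B : {B : Finset α // B ∈ D.powersetCard b} // x ∈ (B : Finset α)} * D.card =
      b * Nat.card {B : Finset α // B ∈ D.powersetCard b} := by
  obtain ⟨b, rfl⟩ : ∃ c, b = c + 1 := ⟨b - 1, by lia⟩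
  have hcard : (D.erase x).card + 1 = D.card := Finset.card_erase_add_one hx
  have h : Nat.card {B : {B : Finset α // B ∈ D.powersetCard (b + 1)} // x ∈ (B : Finset α)} =
      (D.erase x).card.choose b := by
    have hsub := Finset.card_filter_powersetCard_subset {x} D (b + 1)
      (Finset.singleton_subset_iff.2 hx) (by simp)
    rw [Nat.card_congr (Equiv.subtypeSubtypeEquivSubtypeInter _ (x ∈ ·)),
      Nat.subtype_card ((D.powersetCard (b + 1)).filter ({x} ⊆ ·)) (by simp), hsub,
      Finset.card_singleton, Nat.add_sub_cancel, ← hcard, Nat.add_sub_cancel]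
  rw [h, Nat.card_eq_fintype_card, Fintype.card_coe, Finset.card_powersetCard, ← hcard]
  linarith [Nat.add_one_mul_choose_eq (D.erase x).card b]

/-- In a fixed round, for a fixed client slot and a fixed iteration, the target client and the
target sample are hit simultaneously with probability `b / (M * N)`. -/
lemma PMF.uniformOfFintype_client_and_sample {α : Type*} [DecidableEq α]
    {R K E M b : ℕ} (hM : 0 < M) (hb : 0 < b) {D : Finset α} {x : α} (hx : x ∈ D) (ku : Fin M)
    [Nonempty (Fin R → (Fin K → Fin M) × (Fin E → {B : Finset α // B ∈ D.powersetCard b}))]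
    (r : Fin R) (j : Fin K) (i : Fin E) :
    (PMF.uniformOfFintype
        (Fin R → (Fin K → Fin M) × (Fin E → {B : Finset α // B ∈ D.powersetCard b}))).toOuterMeasure
      {h | (h r).1 j = ku ∧ x ∈ ((h r).2 i : Finset α)} = b / ((M : ℝ≥0∞) * D.card) := by
  classical
  let 𝓑 := {B : Finset α // B ∈ D.powersetCard b}
  let X := (Fin K → Fin M) × (Fin E → 𝓑)
  let p : X → Prop := fun y ↦ y.1 j = ku ∧ x ∈ (y.2 i : Finset α)
  have h₁ := Nat.card_subtype_eval_mul r p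
  have h₂ := Nat.card_subtype_eval_mul j (· = ku)
  have h₃ := Nat.card_subtype_eval_mul i (fun B : 𝓑 ↦ x ∈ (B : Finset α))
  have h₄ := Finset.card_mem_powersetCard_mul_card hx hb
  have h₅ : Nat.card {y // p y} = Nat.card {f : Fin K → Fin M // f j = ku} *
      Nat.card {f : Fin E → 𝓑 // x ∈ (f i : Finset α)} := by
    rw [← Nat.card_prod]
    exact Nat.card_congr (Equiv.subtypeProdEquivProd (p := fun f : Fin K → Fin M ↦ f j = ku)
      (q := fun f : Fin E → 𝓑 ↦ x ∈ (f i : Finset α)))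
  have hX : Nat.card X = Nat.card (Fin K → Fin M) * Nat.card (Fin E → 𝓑) := Nat.card_prod _ _
  have hD : 0 < D.card := Finset.card_pos.2 ⟨x, hx⟩
  have hne : Nonempty (Fin R → X) := inferInstance
  have hXne : Nonempty X := hne.map (· r)
  have hBne : Nonempty 𝓑 := hXne.map (·.2 i)
  have hXpos : 0 < Nat.card X := Nat.card_pos
  have hBpos : 0 < Nat.card 𝓑 := Nat.card_pos
  have hpos : 0 < Nat.card (Fin R → X) := Nat.card_pos
  have key : Nat.card {h : Fin R → X // p (h r)} * (M * D.card) = b * Nat.card (Fin R → X) := by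
    rw [Nat.card_eq_fintype_card (α := Fin M), Fintype.card_fin,
      Nat.card_unique (α := {y // y = ku}), one_mul] at h₂
    have h₆ : Nat.card {f : Fin E → 𝓑 // x ∈ (f i : Finset α)} * D.card =
        b * Nat.card (Fin E → 𝓑) := by
      refine Nat.eq_of_mul_eq_mul_right hBpos ?_
      linear_combination D.card * h₃ + Nat.card (Fin E → 𝓑) * h₄
    refine Nat.eq_of_mul_eq_mul_right hXpos ?_
    calc _ = Nat.card {h : Fin R → X // p (h r)} * Nat.card X * (M * D.card) := by ring
      _ = (Nat.card {f : Fin K → Fin M // f j = ku} * M) *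
          (Nat.card {f : Fin E → 𝓑 // x ∈ (f i : Finset α)} * D.card) *
            Nat.card (Fin R → X) := by rw [h₁, h₅]; ring
      _ = Nat.card (Fin K → Fin M) * (b * Nat.card (Fin E → 𝓑)) * Nat.card (Fin R → X) :=
        congrArg₂ (· * · * _) h₂ h₆
      _ = _ := by rw [hX]; ring
  rw [PMF.toOuterMeasure_uniformOfFintype_apply, ← Nat.card_eq_fintype_card,
    ← Nat.card_eq_fintype_card]
  change (Nat.card {h : Fin R → X // p (h r)} : ℝ≥0∞) / (Nat.card (Fin R → X) : ℝ≥0∞) = _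
  rw [ENNReal.div_eq_div_iff (by simp [hM.ne', hD.ne'])
    (ENNReal.mul_ne_top (by simp) (by simp)) (by exact_mod_cast hpos.ne') (by simp)]
  rw [mul_comm, mul_comm _ (b : ℝ≥0∞)]
  exact_mod_cast key

/-- FATS sample-level TV-stability key bound. A sampling history consists, for each of the
`R` rounds, of `K` client indices drawn i.i.d. uniformly from the `M` clients and `E`
mini-batches drawn i.i.d. uniformly among the `b`-element subsets of the target client's
`N`-element dataset `D`; all draws are mutually independent, so the history is uniformly
distributed on the product type. The probability that in some round the target client `ku`
is selected and the target sample `x` appears in one of that round's mini-batches is at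
most `R·K·E·b/(M·N)`. -/
theorem fats_sample_recompute_prob {α : Type*} [DecidableEq α]
    (R K E M N b : ℕ) (hR : 0 < R) (hK : 0 < K) (hE : 0 < E) (hM : 0 < M)
    (hN : 0 < N) (hb : 0 < b) (hbN : b ≤ N)
    (D : Finset α) (hD : D.card = N) (x : α) (hx : x ∈ D) (ku : Fin M)
    [Nonempty (Fin R → (Fin K → Fin M) × (Fin E → {B : Finset α // B ∈ D.powersetCard b}))] :
    (PMF.uniformOfFintype
        (Fin R → (Fin K → Fin M) × (Fin E → {B : Finset α // B ∈ D.powersetCard b}))).toOuterMeasure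
      {h | ∃ r, (∃ j, (h r).1 j = ku) ∧ ∃ i, x ∈ ((h r).2 i : Finset α)}
      ≤ (R : ℝ≥0∞) * K * E * b / ((M : ℝ≥0∞) * N) := by
  subst hD
  calc _ ≤ (PMF.uniformOfFintype (Fin R → (Fin K → Fin M) ×
          (Fin E → {B : Finset α // B ∈ D.powersetCard b}))).toOuterMeasure
        (⋃ t : Fin R × Fin K × Fin E,
          {h | (h t.1).1 t.2.1 = ku ∧ x ∈ ((h t.1).2 t.2.2 : Finset α)}) := by
        refine measure_mono ?_
        rintro h ⟨r, ⟨j, hj⟩, i, hi⟩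
        exact Set.mem_iUnion.2 ⟨(r, j, i), hj, hi⟩
    _ ≤ ∑ t : Fin R × Fin K × Fin E, (PMF.uniformOfFintype (Fin R → (Fin K → Fin M) ×
          (Fin E → {B : Finset α // B ∈ D.powersetCard b}))).toOuterMeasure
          {h | (h t.1).1 t.2.1 = ku ∧ x ∈ ((h t.1).2 t.2.2 : Finset α)} :=
        measure_iUnion_fintype_le _ _
    _ = _ := by
        simp_rw [PMF.uniformOfFintype_client_and_sample hM hb hx]
        simp [mul_assoc, mul_div_assoc]
end

section
/- Let L, G > 0 and F0 > F⋆ be reals, let ρ_S, ρ_C ∈ (0, 1], let M, N be positive integers, and let λ ≥ 1. Define Γ := G² / (L (F0 − F⋆) ρ_S M N). Let T and E be positive reals with T ≥ 2λ/√Γ and E/T < (1/2)√(Γ/λ), and set η := 1/(L √Γ T). If a real number D ≥ 0 satisfies D ≤ 2(F0 − F⋆)/(η T) + η² L² G² E (ρ_C E M + T)/(ρ_S M N) + η L G² T/(ρ_S M N), then D ≤ 3 √(L G² (F0 − F⋆)) / √(ρ_S M N) + L (F0 − F⋆) (E/T) (ρ_C M E / T + 1). -/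
open Real

/-- Theorem 2 (convergence of FATS), quantitative content: with
`Γ = G²/(L(F0−F⋆)ρ_S M N)`, learning rate `η = 1/(L√Γ T)`, `T ≥ 2λ/√Γ` and
`E/T < (1/2)√(Γ/λ)`, the bound of Lemma 2 implies the bound
`3√(LG²(F0−F⋆))/√(ρ_S M N) + L(F0−F⋆)(E/T)(ρ_C M E/T + 1)`. -/
theorem fats_convergence_bound
    (L G F0 Fstar ρS ρC lam Γ T E η D : ℝ) (M N : ℕ)
    (hL : 0 < L) (hG : 0 < G) (hF : Fstar < F0)
    (hρS0 : 0 < ρS) (hρS1 : ρS ≤ 1) (hρC0 : 0 < ρC) (hρC1 : ρC ≤ 1)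
    (hM : 0 < M) (hN : 0 < N) (hlam : 1 ≤ lam)
    (hΓ : Γ = G ^ 2 / (L * (F0 - Fstar) * ρS * M * N))
    (hT0 : 0 < T) (hE0 : 0 < E)
    (hT : T ≥ 2 * lam / Real.sqrt Γ)
    (hE : E / T < (1 / 2) * Real.sqrt (Γ / lam))
    (hη : η = 1 / (L * Real.sqrt Γ * T))
    (hD0 : 0 ≤ D)
    (hD : D ≤ 2 * (F0 - Fstar) / (η * T)
        + η ^ 2 * L ^ 2 * G ^ 2 * E * (ρC * E * M + T) / (ρS * M * N)
        + η * L * G ^ 2 * T / (ρS * M * N)) :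
    D ≤ 3 * Real.sqrt (L * G ^ 2 * (F0 - Fstar)) / Real.sqrt (ρS * M * N)
        + L * (F0 - Fstar) * (E / T) * (ρC * M * E / T + 1) := by
  have hΔ : 0 < F0 - Fstar := sub_pos.mpr hF
  have hM' : (0 : ℝ) < M := Nat.cast_pos.mpr hM
  have hN' : (0 : ℝ) < N := Nat.cast_pos.mpr hN
  have hP : 0 < ρS * M * N := by positivity
  have hΓ0 : 0 < Γ := by rw [hΓ]; positivity
  have hs : 0 < √Γ := Real.sqrt_pos.mpr hΓ0
  have hs2 : √Γ ^ 2 = Γ := Real.sq_sqrt hΓ0.le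
  have hG2 : G ^ 2 = √Γ ^ 2 * (L * (F0 - Fstar)) * (ρS * M * N) := by
    rw [hs2, hΓ]
    field_simp
  have hsqrt : √(L * G ^ 2 * (F0 - Fstar)) / √(ρS * M * N) = L * (F0 - Fstar) * √Γ := by
    have h : L * G ^ 2 * (F0 - Fstar) = (L * (F0 - Fstar) * √Γ) ^ 2 * (ρS * M * N) := by
      rw [hG2]
      ring
    rw [h, Real.sqrt_mul (sq_nonneg _), Real.sqrt_sq (by positivity),
      mul_div_cancel_right₀ _ (Real.sqrt_pos.mpr hP).ne']
  refine hD.trans_eq ?_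
  rw [mul_div_assoc 3, hsqrt, hG2, hη]
  generalize √Γ = s at hs
  generalize F0 - Fstar = Δ at hΔ
  field_simp
  ring
end

section
/- Let L, G > 0 and F0 > F⋆ be reals, let ρ_S, ρ_C ∈ (0, 1], let M, N be positive integers, and let λ ≥ 1. Define Γ := G² / (L (F0 − F⋆) ρ_S M N). Let 0 < α ≤ 1, let T be a positive real with T ≥ max{ 2λ/√Γ, (2√(λ/Γ))^{1/α}, (ρ_C M)^{1/α} }, and set E := T^{1−α}. If a real number D ≥ 0 satisfies D ≤ 3 √(L G² (F0 − F⋆)) / √(ρ_S M N) + L (F0 − F⋆) (E/T) (ρ_C M E / T + 1), then D ≤ 4 G √(L (F0 − F⋆)) / √(ρ_S M N). -/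
open Real

/-- Corollary 1, first case (E = T^{1−α}): with `Γ = G²/(L(F0−F⋆)ρ_S M N)`, `0 < α ≤ 1`,
`T ≥ max{2λ/√Γ, (2√(λ/Γ))^{1/α}, (ρ_C M)^{1/α}}` and `E = T^{1−α}`, the bound of
Theorem 2 implies `D ≤ 4G√(L(F0−F⋆))/√(ρ_S M N)`. -/
theorem fats_convergence_corollary_one
    (L G F0 Fstar ρS ρC lam Γ α T E D : ℝ) (M N : ℕ)
    (hL : 0 < L) (hG : 0 < G) (hF : Fstar < F0)
    (hρS0 : 0 < ρS) (hρS1 : ρS ≤ 1) (hρC0 : 0 < ρC) (hρC1 : ρC ≤ 1)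
    (hM : 0 < M) (hN : 0 < N) (hlam : 1 ≤ lam)
    (hΓ : Γ = G ^ 2 / (L * (F0 - Fstar) * ρS * M * N))
    (hα0 : 0 < α) (hα1 : α ≤ 1) (hT0 : 0 < T)
    (hT1 : T ≥ 2 * lam / Real.sqrt Γ)
    (hT2 : T ≥ (2 * Real.sqrt (lam / Γ)) ^ (1 / α))
    (hT3 : T ≥ (ρC * M) ^ (1 / α))
    (hE : E = T ^ (1 - α))
    (hD0 : 0 ≤ D)
    (hD : D ≤ 3 * Real.sqrt (L * G ^ 2 * (F0 - Fstar)) / Real.sqrt (ρS * M * N)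
        + L * (F0 - Fstar) * (E / T) * (ρC * M * E / T + 1)) :
    D ≤ 4 * G * Real.sqrt (L * (F0 - Fstar)) / Real.sqrt (ρS * M * N) := by
  have hMR : (0 : ℝ) < M := by exact_mod_cast hM
  have hNR : (0 : ℝ) < N := by exact_mod_cast hN
  have hA : 0 < L * (F0 - Fstar) := mul_pos hL (sub_pos.2 hF)
  have hP : 0 < ρS * M * N := by positivity
  have hGA : Real.sqrt (L * G ^ 2 * (F0 - Fstar)) = G * Real.sqrt (L * (F0 - Fstar)) := by
    rw [show L * G ^ 2 * (F0 - Fstar) = G ^ 2 * (L * (F0 - Fstar)) by ring,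
      Real.sqrt_mul (sq_nonneg G), Real.sqrt_sq hG.le]
  have hΓ' : Γ = G ^ 2 / ((L * (F0 - Fstar)) * (ρS * M * N)) := by rw [hΓ]; ring_nf
  rw [hGA] at hD
  generalize L * (F0 - Fstar) = A at *
  generalize ρS * M * N = P at *
  have ha : 0 < Real.sqrt A := Real.sqrt_pos.2 hA
  have hp : 0 < Real.sqrt P := Real.sqrt_pos.2 hP
  have hAa : Real.sqrt A ^ 2 = A := Real.sq_sqrt hA.le
  have hΓpos : 0 < Γ := by rw [hΓ']; positivity
  have hsΓ : Real.sqrt Γ = G / (Real.sqrt A * Real.sqrt P) := by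
    rw [hΓ', Real.sqrt_div (sq_nonneg G), Real.sqrt_sq hG.le, Real.sqrt_mul hA.le]
  have hTα : 0 < T ^ α := Real.rpow_pos_of_pos hT0 α
  have hET : E / T = (T ^ α)⁻¹ := by
    rw [hE, Real.rpow_sub hT0, Real.rpow_one]
    field_simp
  have hMT : ρC * M ≤ T ^ α := by
    rw [ge_iff_le, one_div] at hT3
    exact (Real.rpow_inv_le_iff_of_pos (by positivity) hT0.le hα0).1 hT3
  have hΓT : 2 / Real.sqrt Γ ≤ T ^ α := by
    rw [ge_iff_le, one_div] at hT2
    refine le_trans ?_ ((Real.rpow_inv_le_iff_of_pos (by positivity) hT0.le hα0).1 hT2)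
    rw [Real.sqrt_div (by linarith), ← mul_div_assoc]
    have := Real.one_le_sqrt.2 hlam
    gcongr
    linarith
  have hx : 2 * (T ^ α)⁻¹ ≤ Real.sqrt Γ := by
    rw [div_le_iff₀ (Real.sqrt_pos.2 hΓpos)] at hΓT
    rwa [← div_eq_mul_inv, div_le_iff₀ hTα, mul_comm]
  have hCx : ρC * M * E / T ≤ 1 := by
    rw [mul_div_assoc, hET, ← div_eq_mul_inv]
    exact (div_le_one hTα).2 hMT
  have hsecond : A * (E / T) * (ρC * M * E / T + 1) ≤ G * Real.sqrt A / Real.sqrt P := by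
    calc A * (E / T) * (ρC * M * E / T + 1)
        ≤ A * (E / T) * 2 := by
          have : 0 ≤ A * (E / T) := by rw [hET]; positivity
          exact mul_le_mul_of_nonneg_left (by linarith) this
      _ = A * (2 * (T ^ α)⁻¹) := by rw [hET]; ring
      _ ≤ A * Real.sqrt Γ := mul_le_mul_of_nonneg_left hx hA.le
      _ = Real.sqrt A ^ 2 * (G / (Real.sqrt A * Real.sqrt P)) := by rw [hsΓ, hAa]
      _ = G * Real.sqrt A / Real.sqrt P := by field_simp
  calc D ≤ 3 * (G * Real.sqrt A) / Real.sqrt P + G * Real.sqrt A / Real.sqrt P := by linarith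
    _ = 4 * G * Real.sqrt A / Real.sqrt P := by ring
end

section
/- Let L, G > 0 and F0 > F⋆ be reals, let ρ_S, ρ_C ∈ (0, 1], let λ ≥ 1, and let N be a positive integer. Define Γ := G² / (L (F0 − F⋆) ρ_S M N) and suppose M is a positive integer with M < (4 λ² L (F0 − F⋆) ρ_S / (G² ρ_C²)) · N. Let c be a real constant with 0 < c < (1/2)√(Γ/λ), let T ≥ 2λ/√Γ be a positive real, and set E := c·T. If a real number D ≥ 0 satisfies D ≤ 3 √(L G² (F0 − F⋆)) / √(ρ_S M N) + L (F0 − F⋆) (E/T) (ρ_C M E / T + 1), then D ≤ 4 G √(L (F0 − F⋆)) / √(ρ_S M N). -/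
open Real

/-- Corollary 1, second case (E = c·T): with `Γ = G²/(L(F0−F⋆)ρ_S M N)`,
`M < (4λ²L(F0−F⋆)ρ_S/(G²ρ_C²))·N`, `0 < c < (1/2)√(Γ/λ)`, `T ≥ 2λ/√Γ` and `E = c·T`,
the bound of Theorem 2 implies `D ≤ 4G√(L(F0−F⋆))/√(ρ_S M N)`. -/
theorem fats_convergence_corollary_two
    (L G F0 Fstar ρS ρC lam Γ c T E D : ℝ) (M N : ℕ)
    (hL : 0 < L) (hG : 0 < G) (hF : Fstar < F0)
    (hρS0 : 0 < ρS) (hρS1 : ρS ≤ 1) (hρC0 : 0 < ρC) (hρC1 : ρC ≤ 1)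
    (hM : 0 < M) (hN : 0 < N) (hlam : 1 ≤ lam)
    (hΓ : Γ = G ^ 2 / (L * (F0 - Fstar) * ρS * M * N))
    (hMN : (M : ℝ) < 4 * lam ^ 2 * L * (F0 - Fstar) * ρS / (G ^ 2 * ρC ^ 2) * N)
    (hc0 : 0 < c) (hc1 : c < (1 / 2) * Real.sqrt (Γ / lam))
    (hT0 : 0 < T) (hT1 : T ≥ 2 * lam / Real.sqrt Γ)
    (hE : E = c * T)
    (hD0 : 0 ≤ D)
    (hD : D ≤ 3 * Real.sqrt (L * G ^ 2 * (F0 - Fstar)) / Real.sqrt (ρS * M * N)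
        + L * (F0 - Fstar) * (E / T) * (ρC * M * E / T + 1)) :
    D ≤ 4 * G * Real.sqrt (L * (F0 - Fstar)) / Real.sqrt (ρS * M * N) := by
  have hA : 0 < L * (F0 - Fstar) := mul_pos hL (sub_pos.2 hF)
  have hM' : (0 : ℝ) < M := Nat.cast_pos.2 hM
  have hN' : (0 : ℝ) < N := Nat.cast_pos.2 hN
  have hlam0 : 0 < lam := zero_lt_one.trans_le hlam
  have hP : 0 < ρS * M * N := by positivity
  have hsqrt : √(L * G ^ 2 * (F0 - Fstar)) = G * √(L * (F0 - Fstar)) := by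
    rw [show L * G ^ 2 * (F0 - Fstar) = G ^ 2 * (L * (F0 - Fstar)) by ring,
      Real.sqrt_mul (sq_nonneg G), Real.sqrt_sq hG.le]
  have hET : E / T = c := by rw [hE, mul_div_cancel_right₀ _ hT0.ne']
  rw [hsqrt, mul_div_assoc (ρC * M) E T, hET] at hD
  clear hsqrt hET hE hT1 hT0
  set A := L * (F0 - Fstar) with hAdef
  have hΓpos : 0 < Γ := by rw [hΓ]; positivity
  have hs : 0 < √Γ := Real.sqrt_pos.2 hΓpos
  have hssq : √Γ ^ 2 = Γ := Real.sq_sqrt hΓpos.le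
  have hAs : G * √A / √(ρS * M * N) = A * √Γ := by
    rw [hΓ, show A * ρS * M * N = A * (ρS * M * N) by ring, Real.sqrt_div (sq_nonneg G),
      Real.sqrt_sq hG.le, Real.sqrt_mul hA.le]
    have h1 := Real.sqrt_pos.2 hA
    have h2 := Real.sqrt_pos.2 hP
    field_simp
    rw [Real.sq_sqrt hA.le]
  have hMs : ρC * M * √Γ ≤ 2 * lam := by
    refine abs_le_of_sq_le_sq' ?_ (by positivity) |>.2
    have h : ρC ^ 2 * M * G ^ 2 ≤ 4 * lam ^ 2 * A * ρS * N := by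
      rw [div_mul_eq_mul_div, lt_div_iff₀ (by positivity)] at hMN
      rw [hAdef]
      linarith
    rw [mul_pow, hssq, hΓ, mul_div_assoc', div_le_iff₀ (by positivity)]
    have := mul_le_mul_of_nonneg_right h hM'.le
    linarith
  have hcsq : c ^ 2 * (4 * lam) ≤ √Γ ^ 2 := by
    have h := pow_le_pow_left₀ hc0.le hc1.le 2
    rw [mul_pow, Real.sq_sqrt (by positivity), mul_div_assoc', le_div_iff₀ hlam0] at h
    rw [hssq]
    linarith
  have hc : 2 * c ≤ √Γ := by
    refine abs_le_of_sq_le_sq' ?_ hs.le |>.2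
    nlinarith [sq_nonneg c]
  have hquad : ρC * M * c ^ 2 ≤ √Γ / 2 := by
    refine le_of_mul_le_mul_right ?_ (show 0 < 4 * lam by positivity)
    calc ρC * M * c ^ 2 * (4 * lam) = ρC * M * (c ^ 2 * (4 * lam)) := by ring
      _ ≤ ρC * M * √Γ ^ 2 := by gcongr
      _ = ρC * M * √Γ * √Γ := by ring
      _ ≤ 2 * lam * √Γ := by gcongr
      _ = √Γ / 2 * (4 * lam) := by ring
  have hcomm : A * c * (ρC * M * c + 1) ≤ A * √Γ := by
    rw [mul_assoc]
    refine mul_le_mul_of_nonneg_left ?_ hA.le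
    linarith
  calc D ≤ 3 * (G * √A) / √(ρS * M * N) + A * c * (ρC * M * c + 1) := hD
    _ ≤ 3 * (G * √A) / √(ρS * M * N) + G * √A / √(ρS * M * N) := by rw [hAs]; gcongr
    _ = 4 * G * √A / √(ρS * M * N) := by ring
end
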